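/- arXiv:2209.04890 — 4 statements merged into one kernel-verified Lean document; each statement's English description precedes it below -/
import Mathlib

section
/- Let X be a connected finite graph, S an orientation of X, G a finite group, α : S → G a voltage assignment (extended to E_X by α(s̄) = α(s)⁻¹), and v₀ a fixed vertex of X. For a walk c = e₁⋯e_n set α(c) := α(e₁)·α(e₂)⋯α(e_n) ∈ G. Then the derived graph X(G,S,α) is connected if and only if every element of G is of the form α(c) for some closed walk c based at v₀ (i.e. a walk with o(e₁) = t(e_n) = v₀); equivalently, if and only if the homomorphism ρ_α from the fundamental group of X at v₀ to G induced by α is surjective. -/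
/-- A graph in the sense of Serre: vertices, directed edges, origin and terminus maps,
and a fixed-point-free involution on directed edges. -/
structure SerreGraph where
  V : Type
  E : Type
  o : E → V
  t : E → V
  bar : E → E
  bar_ne : ∀ e, bar e ≠ e
  bar_bar : ∀ e, bar (bar e) = e
  o_bar : ∀ e, o (bar e) = t e
  t_bar : ∀ e, t (bar e) = o e

namespace SerreGraph

variable (X : SerreGraph)

/-- Two vertices are adjacent if some directed edge goes from the first to the second. -/
def Adj (v w : X.V) : Prop := ∃ e, X.o e = v ∧ X.t e = w

/-- A graph is connected if any two vertices are joined by a walk. -/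
def Connected : Prop := ∀ v w : X.V, Relation.ReflTransGen X.Adj v w

/-- An orientation: a set of directed edges containing exactly one of `e`, `bar e` for each `e`. -/
def IsOrientation (S : Set X.E) : Prop := ∀ e, e ∈ S ↔ X.bar e ∉ S

/-- The type of undirected edges: directed edges modulo the involution. -/
def barRel (e f : X.E) : Prop := f = X.bar e

/-- The type of undirected edges: directed edges modulo the involution. -/
def und : Type := Quot X.barRel

/-- The undirected edge underlying a directed edge. -/
def undMk (e : X.E) : X.und := Quot.mk X.barRel e

theorem undMk_bar (e : X.E) : X.undMk (X.bar e) = X.undMk e :=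
  (Quot.sound (r := X.barRel) (a := e) (b := X.bar e) rfl).symm

/-- The Euler characteristic: number of vertices minus number of undirected edges. -/
noncomputable def eulerChar : ℤ := (Nat.card X.V : ℤ) - (Nat.card X.und : ℤ)

theorem bar_mem_orientation {S : Set X.E} (hS : X.IsOrientation S) {e : X.E} (h : e ∉ S) :
    X.bar e ∈ S := by
  by_contra hb
  exact h ((hS e).mpr hb)

variable (S : Set X.E) (hS : X.IsOrientation S) {G : Type} [Group G]

open Classical in
/-- The extension of a voltage assignment `α : S → G` to all directed edges,
via `α (bar s) = (α s)⁻¹`. -/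
noncomputable def voltExt (α : S → G) : X.E → G := fun e =>
  if h : e ∈ S then α ⟨e, h⟩ else (α ⟨X.bar e, X.bar_mem_orientation hS h⟩)⁻¹

theorem voltExt_bar (α : S → G) (e : X.E) :
    X.voltExt S hS α (X.bar e) = (X.voltExt S hS α e)⁻¹ := by
  by_cases h : e ∈ S
  · have hb : X.bar e ∉ S := (hS e).mp h
    rw [voltExt, voltExt, dif_neg hb, dif_pos h]
    have : (⟨X.bar (X.bar e), X.bar_mem_orientation hS hb⟩ : S) = ⟨e, h⟩ :=
      Subtype.ext (X.bar_bar e)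
    rw [this]
  · have hb : X.bar e ∈ S := X.bar_mem_orientation hS h
    rw [voltExt, voltExt, dif_pos hb, dif_neg h, inv_inv]

/-- The derived graph `X(G, S, α)` attached to a voltage assignment `α : S → G`. -/
noncomputable def derived (α : S → G) : SerreGraph where
  V := X.V × G
  E := X.E × G
  o := fun p => (X.o p.1, p.2)
  t := fun p => (X.t p.1, p.2 * X.voltExt S hS α p.1)
  bar := fun p => (X.bar p.1, p.2 * X.voltExt S hS α p.1)
  bar_ne := fun p h => X.bar_ne p.1 (congrArg Prod.fst h)
  bar_bar := fun p => by
    refine Prod.ext (X.bar_bar p.1) ?_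
    show p.2 * X.voltExt S hS α p.1 * X.voltExt S hS α (X.bar p.1) = p.2
    rw [X.voltExt_bar S hS α, mul_assoc, mul_inv_cancel, mul_one]
  o_bar := fun p => Prod.ext (X.o_bar p.1) rfl
  t_bar := fun p => by
    refine Prod.ext (X.t_bar p.1) ?_
    show p.2 * X.voltExt S hS α p.1 * X.voltExt S hS α (X.bar p.1) = p.2
    rw [X.voltExt_bar S hS α, mul_assoc, mul_inv_cancel, mul_one]

end SerreGraph

/-- A morphism of graphs. -/
@[ext] structure GraphMorphism (Y X : SerreGraph) where
  onV : Y.V → X.V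
  onE : Y.E → X.E
  map_o : ∀ e, onV (Y.o e) = X.o (onE e)
  map_t : ∀ e, onV (Y.t e) = X.t (onE e)
  map_bar : ∀ e, onE (Y.bar e) = X.bar (onE e)

namespace GraphMorphism

/-- The identity morphism. -/
def id (X : SerreGraph) : GraphMorphism X X :=
  ⟨_root_.id, _root_.id, fun _ => rfl, fun _ => rfl, fun _ => rfl⟩

/-- Composition of graph morphisms. -/
def comp {Z Y X : SerreGraph} (f : GraphMorphism Y X) (g : GraphMorphism Z Y) :
    GraphMorphism Z X where
  onV := f.onV ∘ g.onV
  onE := f.onE ∘ g.onE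
  map_o e := by simp [Function.comp, g.map_o, f.map_o]
  map_t e := by simp [Function.comp, g.map_t, f.map_t]
  map_bar e := by simp [Function.comp, g.map_bar, f.map_bar]

/-- The preimage of an orientation under a graph morphism is an orientation. -/
theorem orientation_preimage {Y X : SerreGraph} (f : GraphMorphism Y X) {S : Set X.E}
    (hS : X.IsOrientation S) : Y.IsOrientation (f.onE ⁻¹' S) := by
  intro e
  constructor
  · intro h hb
    rw [Set.mem_preimage, f.map_bar] at hb
    exact (hS (f.onE e)).mp h hb
  · intro h
    rw [Set.mem_preimage] at h ⊢
    rw [f.map_bar] at h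
    exact (hS (f.onE e)).mpr h

end GraphMorphism

/-- A cover of graphs: surjective on vertices and a local bijection on edges at each vertex. -/
def IsCover {Y X : SerreGraph} (f : GraphMorphism Y X) : Prop :=
  Function.Surjective f.onV ∧
    ∀ w : Y.V, Set.BijOn f.onE {e | Y.o e = w} {e | X.o e = f.onV w}

/-- The projection from the derived graph to the base graph. -/
noncomputable def SerreGraph.derivedProj (X : SerreGraph) (S : Set X.E)
    (hS : X.IsOrientation S) {G : Type} [Group G] (α : S → G) :
    GraphMorphism (X.derived S hS α) X where
  onV := Prod.fst
  onE := Prod.fst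
  map_o _ := rfl
  map_t _ := rfl
  map_bar _ := rfl

/-- An automorphism of a graph. -/
@[ext] structure GraphAut (X : SerreGraph) where
  vEquiv : X.V ≃ X.V
  eEquiv : X.E ≃ X.E
  map_o : ∀ e, vEquiv (X.o e) = X.o (eEquiv e)
  map_t : ∀ e, vEquiv (X.t e) = X.t (eEquiv e)
  map_bar : ∀ e, eEquiv (X.bar e) = X.bar (eEquiv e)

instance (X : SerreGraph) : Group (GraphAut X) where
  one := ⟨Equiv.refl _, Equiv.refl _, fun _ => rfl, fun _ => rfl, fun _ => rfl⟩
  mul a b := ⟨b.vEquiv.trans a.vEquiv, b.eEquiv.trans a.eEquiv,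
    fun e => by simp [b.map_o, a.map_o],
    fun e => by simp [b.map_t, a.map_t],
    fun e => by simp [b.map_bar, a.map_bar]⟩
  inv a := ⟨a.vEquiv.symm, a.eEquiv.symm,
    fun e => by rw [Equiv.symm_apply_eq, a.map_o, Equiv.apply_symm_apply],
    fun e => by rw [Equiv.symm_apply_eq, a.map_t, Equiv.apply_symm_apply],
    fun e => by rw [Equiv.symm_apply_eq, a.map_bar, Equiv.apply_symm_apply]⟩
  mul_assoc a b c := by ext x <;> rfl
  one_mul a := by ext x <;> rfl
  mul_one a := by ext x <;> rfl
  inv_mul_cancel a := by ext x <;> exact Equiv.symm_apply_apply _ _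

/-- The group of covering transformations of a morphism `f : Y → X`:
automorphisms `σ` of `Y` with `f ∘ σ = f`. -/
def covAut {Y X : SerreGraph} (f : GraphMorphism Y X) : Subgroup (GraphAut Y) where
  carrier := {σ | (∀ v, f.onV (σ.vEquiv v) = f.onV v) ∧ ∀ e, f.onE (σ.eEquiv e) = f.onE e}
  one_mem' := ⟨fun _ => rfl, fun _ => rfl⟩
  mul_mem' := by
    intro a b ha hb
    exact ⟨fun v => (ha.1 (b.vEquiv v)).trans (hb.1 v),
      fun e => (ha.2 (b.eEquiv e)).trans (hb.2 e)⟩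
  inv_mem' := by
    intro a ha
    constructor
    · intro v
      have h1 := ha.1 (a.vEquiv.symm v)
      rw [Equiv.apply_symm_apply] at h1
      exact h1.symm
    · intro e
      have h1 := ha.2 (a.eEquiv.symm e)
      rw [Equiv.apply_symm_apply] at h1
      exact h1.symm

/-- A Galois cover: a cover with connected total graph whose covering transformations
act transitively on each vertex fiber. -/
def IsGaloisCover {Y X : SerreGraph} (f : GraphMorphism Y X) : Prop :=
  IsCover f ∧ Y.Connected ∧
    ∀ w w' : Y.V, f.onV w = f.onV w' → ∃ σ ∈ covAut f, σ.vEquiv w = w'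

/-- The pullback (fiber product) of two graph morphisms. -/
def pullback {Y₁ Y₂ X : SerreGraph} (p₁ : GraphMorphism Y₁ X) (p₂ : GraphMorphism Y₂ X) :
    SerreGraph where
  V := {q : Y₁.V × Y₂.V // p₁.onV q.1 = p₂.onV q.2}
  E := {q : Y₁.E × Y₂.E // p₁.onE q.1 = p₂.onE q.2}
  o := fun q => ⟨(Y₁.o q.1.1, Y₂.o q.1.2), by
    show p₁.onV (Y₁.o q.1.1) = p₂.onV (Y₂.o q.1.2)
    rw [p₁.map_o, p₂.map_o, q.2]⟩
  t := fun q => ⟨(Y₁.t q.1.1, Y₂.t q.1.2), by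
    show p₁.onV (Y₁.t q.1.1) = p₂.onV (Y₂.t q.1.2)
    rw [p₁.map_t, p₂.map_t, q.2]⟩
  bar := fun q => ⟨(Y₁.bar q.1.1, Y₂.bar q.1.2), by
    show p₁.onE (Y₁.bar q.1.1) = p₂.onE (Y₂.bar q.1.2)
    rw [p₁.map_bar, p₂.map_bar, q.2]⟩
  bar_ne := fun q h => Y₁.bar_ne q.1.1 (congrArg (fun z => z.1.1) h)
  bar_bar := fun q => Subtype.ext (Prod.ext (Y₁.bar_bar q.1.1) (Y₂.bar_bar q.1.2))
  o_bar := fun q => Subtype.ext (Prod.ext (Y₁.o_bar q.1.1) (Y₂.o_bar q.1.2))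
  t_bar := fun q => Subtype.ext (Prod.ext (Y₁.t_bar q.1.1) (Y₂.t_bar q.1.2))

/-- The first projection from the pullback. -/
def pbFst {Y₁ Y₂ X : SerreGraph} (p₁ : GraphMorphism Y₁ X) (p₂ : GraphMorphism Y₂ X) :
    GraphMorphism (pullback p₁ p₂) Y₁ where
  onV := fun q => q.1.1
  onE := fun q => q.1.1
  map_o _ := rfl
  map_t _ := rfl
  map_bar _ := rfl

/-- The second projection from the pullback. -/
def pbSnd {Y₁ Y₂ X : SerreGraph} (p₁ : GraphMorphism Y₁ X) (p₂ : GraphMorphism Y₂ X) :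
    GraphMorphism (pullback p₁ p₂) Y₂ where
  onV := fun q => q.1.2
  onE := fun q => q.1.2
  map_o _ := rfl
  map_t _ := rfl
  map_bar _ := rfl

namespace SerreGraph

/-- A walk in a graph from `v` to `w`: a composable sequence of directed edges. -/
inductive Walk (X : SerreGraph) : X.V → X.V → Type where
  | nil (v : X.V) : Walk X v v
  | cons (e : X.E) {w : X.V} (p : Walk X (X.t e) w) : Walk X (X.o e) w

/-- The voltage `α(c) = α(e₁)·α(e₂)⋯α(e_n)` of a walk `c = e₁e₂⋯e_n`, computed with the
extension of the voltage assignment `α : S → G` to all directed edges. -/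
noncomputable def Walk.voltage {X : SerreGraph} {S : Set X.E} (hS : X.IsOrientation S)
    {G : Type} [Group G] (α : S → G) : {v w : X.V} → X.Walk v w → G
  | _, _, .nil _ => 1
  | _, _, .cons e p => X.voltExt S hS α e * p.voltage hS α

end SerreGraph

namespace SerreGraph

namespace Walk

variable {X : SerreGraph}

/-- Concatenation of walks. -/
def append : {u v w : X.V} → X.Walk u v → X.Walk v w → X.Walk u w
  | _, _, _, .nil _, q => q
  | _, _, _, .cons e p, q => .cons e (p.append q)

variable {S : Set X.E} (hS : X.IsOrientation S) {G : Type} [Group G] (α : S → G)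

theorem voltage_append {u v w : X.V} (p : X.Walk u v) (q : X.Walk v w) :
    (p.append q).voltage hS α = p.voltage hS α * q.voltage hS α := by
  induction p with
  | nil v => simp [append, voltage]
  | cons e p ih => simp [append, voltage, ih, mul_assoc]

/-- The lift of a walk to the derived graph starting in the sheet `σ`. -/
theorem reflTransGen_derived {v w : X.V} (c : X.Walk v w) (σ : G) :
    Relation.ReflTransGen (X.derived S hS α).Adj (v, σ) (w, σ * c.voltage hS α) := by
  induction c generalizing σ with
  | nil v => simpa [voltage] using Relation.ReflTransGen.refl
  | cons e p ih =>
    rw [voltage, ← mul_assoc]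
    exact .head ⟨(e, σ), rfl, rfl⟩ (ih _)

end Walk

theorem nonempty_walk_of_reflTransGen {X : SerreGraph} {v w : X.V}
    (h : Relation.ReflTransGen X.Adj v w) : Nonempty (X.Walk v w) := by
  induction h using Relation.ReflTransGen.head_induction_on with
  | refl => exact ⟨.nil w⟩
  | head hab _ ih =>
    obtain ⟨e, rfl, rfl⟩ := hab
    exact ih.map (.cons e)

/-- Every walk in the derived graph projects to a walk whose voltage is the change of sheet. -/
theorem exists_walk_of_reflTransGen_derived {X : SerreGraph} {S : Set X.E}
    (hS : X.IsOrientation S) {G : Type} [Group G] (α : S → G)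
    {a b : (X.derived S hS α).V} (h : Relation.ReflTransGen (X.derived S hS α).Adj a b) :
    ∃ c : X.Walk a.1 b.1, a.2 * c.voltage hS α = b.2 := by
  induction h using Relation.ReflTransGen.head_induction_on with
  | refl => exact ⟨.nil _, by simp [Walk.voltage]⟩
  | head hab _ ih =>
    obtain ⟨⟨e, σ⟩, rfl, rfl⟩ := hab
    obtain ⟨c, hc⟩ := ih
    exact ⟨.cons e c, (mul_assoc σ _ (c.voltage hS α)).symm.trans hc⟩

end SerreGraph

/-- Connectedness criterion for derived graphs: for a connected graph `X` with base vertex `v₀`,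
the derived graph `X(G, S, α)` is connected if and only if every element of `G` is the voltage
of some closed walk based at `v₀`, i.e. if and only if the homomorphism
`ρ_α : π₁(X, v₀) → G` induced by `α` is surjective. -/
theorem derived_connected_iff (X : SerreGraph) [Finite X.V] [Finite X.E]
    (hX : X.Connected) (S : Set X.E) (hS : X.IsOrientation S)
    (G : Type) [Group G] [Finite G] (α : S → G) (v₀ : X.V) :
    (X.derived S hS α).Connected ↔
      ∀ g : G, ∃ c : X.Walk v₀ v₀, c.voltage hS α = g := by
  constructor
  · intro h g
    obtain ⟨c, hc⟩ :=
      SerreGraph.exists_walk_of_reflTransGen_derived hS α (h (v₀, 1) (v₀, g))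
    exact ⟨c, by simpa using hc⟩
  · rintro h ⟨v, σ⟩ ⟨w, τ⟩
    obtain ⟨p⟩ := SerreGraph.nonempty_walk_of_reflTransGen (hX v v₀)
    obtain ⟨q⟩ := SerreGraph.nonempty_walk_of_reflTransGen (hX v₀ w)
    obtain ⟨c, hc⟩ := h ((σ * p.voltage hS α)⁻¹ * τ * (q.voltage hS α)⁻¹)
    convert (p.append (c.append q)).reflTransGen_derived hS α σ using 2
    rw [SerreGraph.Walk.voltage_append, SerreGraph.Walk.voltage_append, hc]
    group
end

section
/- Let p₁ : Y₁ → X and p₂ : Y₂ → X be Galois covers of graphs, and assume the pullback Y₁ ×_X Y₂ is connected. Then p := p₁∘π₁ = p₂∘π₂ : Y₁ ×_X Y₂ → X is a Galois cover, and the map Gal(Y₁/X) × Gal(Y₂/X) → Gal(Y₁ ×_X Y₂ / X) sending σ = (σ₁,σ₂) to the automorphism σ̃ defined by σ̃(w₁,w₂) = (σ₁(w₁), σ₂(w₂)) on vertices and σ̃(e₁,e₂) = (σ₁(e₁), σ₂(e₂)) on directed edges is a group isomorphism. -/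
theorem covAut_onV {Y X : SerreGraph} {f : GraphMorphism Y X} (σ : covAut f) (v : Y.V) :
    f.onV ((σ : GraphAut Y).vEquiv v) = f.onV v := σ.2.1 v

theorem covAut_onE {Y X : SerreGraph} {f : GraphMorphism Y X} (σ : covAut f) (e : Y.E) :
    f.onE ((σ : GraphAut Y).eEquiv e) = f.onE e := σ.2.2 e

/-- The automorphism `σ̃` of the pullback `Y₁ ×_X Y₂` induced by a pair
`σ = (σ₁, σ₂)` of covering transformations of `p₁ : Y₁ → X` and `p₂ : Y₂ → X`, defined by
`σ̃(w₁,w₂) = (σ₁ w₁, σ₂ w₂)` on vertices and `σ̃(e₁,e₂) = (σ₁ e₁, σ₂ e₂)` on directed edges. -/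
def prodAut {Y₁ Y₂ X : SerreGraph} (p₁ : GraphMorphism Y₁ X) (p₂ : GraphMorphism Y₂ X)
    (σ : covAut p₁ × covAut p₂) : GraphAut (pullback p₁ p₂) where
  vEquiv :=
    { toFun := fun q => ⟨((σ.1 : GraphAut Y₁).vEquiv q.1.1, (σ.2 : GraphAut Y₂).vEquiv q.1.2), by
        rw [covAut_onV σ.1 q.1.1, covAut_onV σ.2 q.1.2]; exact q.2⟩
      invFun := fun q =>
        ⟨((σ.1 : GraphAut Y₁).vEquiv.symm q.1.1, (σ.2 : GraphAut Y₂).vEquiv.symm q.1.2), by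
        have h1 := covAut_onV σ.1 ((σ.1 : GraphAut Y₁).vEquiv.symm q.1.1)
        have h2 := covAut_onV σ.2 ((σ.2 : GraphAut Y₂).vEquiv.symm q.1.2)
        rw [Equiv.apply_symm_apply] at h1 h2
        rw [← h1, ← h2]; exact q.2⟩
      left_inv := fun q =>
        Subtype.ext (Prod.ext (Equiv.symm_apply_apply _ _) (Equiv.symm_apply_apply _ _))
      right_inv := fun q =>
        Subtype.ext (Prod.ext (Equiv.apply_symm_apply _ _) (Equiv.apply_symm_apply _ _)) }
  eEquiv :=
    { toFun := fun q => ⟨((σ.1 : GraphAut Y₁).eEquiv q.1.1, (σ.2 : GraphAut Y₂).eEquiv q.1.2), by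
        rw [covAut_onE σ.1 q.1.1, covAut_onE σ.2 q.1.2]; exact q.2⟩
      invFun := fun q =>
        ⟨((σ.1 : GraphAut Y₁).eEquiv.symm q.1.1, (σ.2 : GraphAut Y₂).eEquiv.symm q.1.2), by
        have h1 := covAut_onE σ.1 ((σ.1 : GraphAut Y₁).eEquiv.symm q.1.1)
        have h2 := covAut_onE σ.2 ((σ.2 : GraphAut Y₂).eEquiv.symm q.1.2)
        rw [Equiv.apply_symm_apply] at h1 h2
        rw [← h1, ← h2]; exact q.2⟩
      left_inv := fun q =>
        Subtype.ext (Prod.ext (Equiv.symm_apply_apply _ _) (Equiv.symm_apply_apply _ _))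
      right_inv := fun q =>
        Subtype.ext (Prod.ext (Equiv.apply_symm_apply _ _) (Equiv.apply_symm_apply _ _)) }
  map_o := fun e =>
    Subtype.ext (Prod.ext ((σ.1 : GraphAut Y₁).map_o e.1.1) ((σ.2 : GraphAut Y₂).map_o e.1.2))
  map_t := fun e =>
    Subtype.ext (Prod.ext ((σ.1 : GraphAut Y₁).map_t e.1.1) ((σ.2 : GraphAut Y₂).map_t e.1.2))
  map_bar := fun e =>
    Subtype.ext (Prod.ext ((σ.1 : GraphAut Y₁).map_bar e.1.1) ((σ.2 : GraphAut Y₂).map_bar e.1.2))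

theorem IsCover.exists_edge_lift {Y X : SerreGraph} {f : GraphMorphism Y X} (hf : IsCover f)
    (e : X.E) : ∃ e' : Y.E, f.onE e' = e := by
  obtain ⟨w, hw⟩ := hf.1 (X.o e)
  obtain ⟨e', -, he'⟩ := (hf.2 w).surjOn (show X.o e = f.onV w from hw.symm)
  exact ⟨e', he'⟩

/-- Covering transformations agreeing at a vertex agree on the edges starting there. -/
theorem IsCover.covAut_eEquiv_eq {Y X : SerreGraph} {f : GraphMorphism Y X} (hf : IsCover f)
    {a b : GraphAut Y} (ha : a ∈ covAut f) (hb : b ∈ covAut f) (e : Y.E)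
    (h : a.vEquiv (Y.o e) = b.vEquiv (Y.o e)) : a.eEquiv e = b.eEquiv e :=
  (hf.2 (a.vEquiv (Y.o e))).injOn (a.map_o e).symm ((b.map_o e).symm.trans h.symm)
    ((ha.2 e).trans (hb.2 e).symm)

/-- On a connected cover, covering transformations agreeing at one vertex are equal. -/
theorem IsCover.covAut_eq {Y X : SerreGraph} {f : GraphMorphism Y X} (hf : IsCover f)
    (hY : Y.Connected) {a b : GraphAut Y} (ha : a ∈ covAut f) (hb : b ∈ covAut f) (w : Y.V)
    (hw : a.vEquiv w = b.vEquiv w) : a = b := by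
  have hV : ∀ v, a.vEquiv v = b.vEquiv v := by
    intro v
    induction hY w v with
    | refl => exact hw
    | tail _ hadj ih =>
      obtain ⟨e, rfl, rfl⟩ := hadj
      rw [a.map_t, b.map_t, hf.covAut_eEquiv_eq ha hb e ih]
  exact GraphAut.ext (Equiv.ext hV)
    (Equiv.ext fun e => hf.covAut_eEquiv_eq ha hb e (hV (Y.o e)))

section Pullback

variable {Y₁ Y₂ X : SerreGraph} {p₁ : GraphMorphism Y₁ X} {p₂ : GraphMorphism Y₂ X}

theorem comp_pbFst_eq_comp_pbSnd : p₁.comp (pbFst p₁ p₂) = p₂.comp (pbSnd p₁ p₂) :=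
  GraphMorphism.ext (funext fun q => q.2) (funext fun q => q.2)

theorem isCover_comp_pbFst (h₁ : IsCover p₁) (h₂ : IsCover p₂) :
    IsCover (p₁.comp (pbFst p₁ p₂)) := by
  refine ⟨fun x => ?_, fun w => ⟨fun e he => ?_, fun e he e' he' h => ?_, fun e he => ?_⟩⟩
  · obtain ⟨w₁, hw₁⟩ := h₁.1 x
    obtain ⟨w₂, hw₂⟩ := h₂.1 x
    exact ⟨⟨(w₁, w₂), hw₁.trans hw₂.symm⟩, hw₁⟩
  · obtain rfl : (pullback p₁ p₂).o e = w := he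
    exact ((p₁.comp (pbFst p₁ p₂)).map_o e).symm
  · have hw : (pullback p₁ p₂).o e = w := he
    have hw' : (pullback p₁ p₂).o e' = w := he'
    have hfst : p₁.onE e.1.1 = p₁.onE e'.1.1 := h
    have hsnd : p₂.onE e.1.2 = p₂.onE e'.1.2 := e.2.symm.trans (hfst.trans e'.2)
    exact Subtype.ext (Prod.ext
      ((h₁.2 w.1.1).injOn (congrArg (pbFst p₁ p₂).onV hw) (congrArg (pbFst p₁ p₂).onV hw') hfst)
      ((h₂.2 w.1.2).injOn (congrArg (pbSnd p₁ p₂).onV hw) (congrArg (pbSnd p₁ p₂).onV hw') hsnd))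
  · have he₁ : X.o e = p₁.onV w.1.1 := he
    obtain ⟨e₁, ho₁, hp₁⟩ := (h₁.2 w.1.1).surjOn he₁
    obtain ⟨e₂, ho₂, hp₂⟩ := (h₂.2 w.1.2).surjOn (he₁.trans w.2)
    exact ⟨⟨(e₁, e₂), hp₁.trans hp₂.symm⟩, Subtype.ext (Prod.ext ho₁ ho₂), hp₁⟩

theorem prodAut_mem_covAut (σ : covAut p₁ × covAut p₂) :
    prodAut p₁ p₂ σ ∈ covAut (p₁.comp (pbFst p₁ p₂)) :=
  ⟨fun q => covAut_onV σ.1 q.1.1, fun q => covAut_onE σ.1 q.1.1⟩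

variable (p₁ p₂) in
/-- The homomorphism from pairs of covering transformations to covering transformations of the
pullback. -/
def prodAutHom : covAut p₁ × covAut p₂ →* covAut (p₁.comp (pbFst p₁ p₂)) where
  toFun σ := ⟨prodAut p₁ p₂ σ, prodAut_mem_covAut σ⟩
  map_one' := rfl
  map_mul' _ _ := rfl

theorem exists_prodAut_vEquiv_eq (h₁ : IsGaloisCover p₁) (h₂ : IsGaloisCover p₂)
    (w w' : (pullback p₁ p₂).V)
    (h : (p₁.comp (pbFst p₁ p₂)).onV w = (p₁.comp (pbFst p₁ p₂)).onV w') :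
    ∃ σ : covAut p₁ × covAut p₂, (prodAut p₁ p₂ σ).vEquiv w = w' := by
  have hfst : p₁.onV w.1.1 = p₁.onV w'.1.1 := h
  obtain ⟨σ₁, hσ₁, hw₁⟩ := h₁.2.2 _ _ hfst
  obtain ⟨σ₂, hσ₂, hw₂⟩ := h₂.2.2 w.1.2 w'.1.2 (w.2.symm.trans (hfst.trans w'.2))
  exact ⟨(⟨σ₁, hσ₁⟩, ⟨σ₂, hσ₂⟩), Subtype.ext (Prod.ext hw₁ hw₂)⟩

theorem prodAutHom_injective (h₁ : IsCover p₁) (h₂ : IsCover p₂) :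
    Function.Injective (prodAutHom p₁ p₂) := by
  intro σ τ h
  have h' : prodAut p₁ p₂ σ = prodAut p₁ p₂ τ := congrArg Subtype.val h
  have hV (q : (pullback p₁ p₂).V) :
      (prodAut p₁ p₂ σ).vEquiv q = (prodAut p₁ p₂ τ).vEquiv q := by rw [h']
  have hE (q : (pullback p₁ p₂).E) :
      (prodAut p₁ p₂ σ).eEquiv q = (prodAut p₁ p₂ τ).eEquiv q := by rw [h']
  refine Prod.ext (Subtype.ext (GraphAut.ext (Equiv.ext fun v => ?_) (Equiv.ext fun e => ?_)))
    (Subtype.ext (GraphAut.ext (Equiv.ext fun v => ?_) (Equiv.ext fun e => ?_)))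
  · obtain ⟨v', hv'⟩ := h₂.1 (p₁.onV v)
    exact congrArg (fun q => q.1.1) (hV ⟨(v, v'), hv'.symm⟩)
  · obtain ⟨e', he'⟩ := h₂.exists_edge_lift (p₁.onE e)
    exact congrArg (fun q => q.1.1) (hE ⟨(e, e'), he'.symm⟩)
  · obtain ⟨v', hv'⟩ := h₁.1 (p₂.onV v)
    exact congrArg (fun q => q.1.2) (hV ⟨(v', v), hv'⟩)
  · obtain ⟨e', he'⟩ := h₁.exists_edge_lift (p₂.onE e)
    exact congrArg (fun q => q.1.2) (hE ⟨(e', e), he'⟩)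

theorem prodAutHom_surjective (h₁ : IsGaloisCover p₁) (h₂ : IsGaloisCover p₂)
    (hconn : (pullback p₁ p₂).Connected) : Function.Surjective (prodAutHom p₁ p₂) := by
  intro τ
  rcases isEmpty_or_nonempty (pullback p₁ p₂).V with hV | ⟨⟨w⟩⟩
  · have hE : IsEmpty (pullback p₁ p₂).E := Function.isEmpty (pullback p₁ p₂).o
    exact ⟨1, Subtype.ext (GraphAut.ext (Subsingleton.elim _ _) (Subsingleton.elim _ _))⟩
  · obtain ⟨σ, hσ⟩ := exists_prodAut_vEquiv_eq h₁ h₂ w _ (covAut_onV τ w).symm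
    exact ⟨σ, Subtype.ext ((isCover_comp_pbFst h₁.1 h₂.1).covAut_eq hconn
      (prodAut_mem_covAut σ) τ.2 w hσ)⟩

end Pullback

/-- If `p₁ : Y₁ → X` and `p₂ : Y₂ → X` are Galois covers and the pullback `Y₁ ×_X Y₂` is
connected, then `p := p₁ ∘ π₁ = p₂ ∘ π₂ : Y₁ ×_X Y₂ → X` is a Galois cover and
`(σ₁, σ₂) ↦ σ̃` is a group isomorphism
`Gal(Y₁/X) × Gal(Y₂/X) ≃ Gal(Y₁ ×_X Y₂ / X)`. -/
theorem pullback_galois_over_base {Y₁ Y₂ X : SerreGraph}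
    (p₁ : GraphMorphism Y₁ X) (p₂ : GraphMorphism Y₂ X)
    (h₁ : IsGaloisCover p₁) (h₂ : IsGaloisCover p₂)
    (hconn : (pullback p₁ p₂).Connected) :
    p₁.comp (pbFst p₁ p₂) = p₂.comp (pbSnd p₁ p₂) ∧
    IsGaloisCover (p₁.comp (pbFst p₁ p₂)) ∧
      ∃ e : (covAut p₁ × covAut p₂) ≃* covAut (p₁.comp (pbFst p₁ p₂)),
        ∀ σ : covAut p₁ × covAut p₂,
          ((e σ : GraphAut (pullback p₁ p₂))) = prodAut p₁ p₂ σ := by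
  refine ⟨comp_pbFst_eq_comp_pbSnd, ⟨isCover_comp_pbFst h₁.1 h₂.1, hconn, fun w w' h => ?_⟩,
    MulEquiv.ofBijective (prodAutHom p₁ p₂)
      ⟨prodAutHom_injective h₁.1 h₂.1, prodAutHom_surjective h₁ h₂ hconn⟩, fun _ => rfl⟩
  obtain ⟨σ, hσ⟩ := exists_prodAut_vEquiv_eq h₁ h₂ w w' h
  exact ⟨_, prodAut_mem_covAut σ, hσ⟩
end

section
/- Let f : Y → X be a morphism of graphs, S an orientation of X, G a finite abelian group, and α : S → G a voltage assignment. Set S_Y := f⁻¹(S), an orientation of Y. Let π₁ : Y(G, S_Y, α∘f) → Y be the projection, and let π₂ : Y(G, S_Y, α∘f) → X(G,S,α) be the morphism defined by π₂(w,σ) = (f(w),σ) on vertices and π₂(e,σ) = (f(e),σ) on directed edges. Then f∘π₁ = p∘π₂ (where p : X(G,S,α) → X is the projection), and for every graph Z with morphisms α₁ : Z → Y and α₂ : Z → X(G,S,α) satisfying f∘α₁ = p∘α₂ there exists a unique morphism of graphs φ : Z → Y(G, S_Y, α∘f) with π₁∘φ = α₁ and π₂∘φ = α₂; that is, (Y(G,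 S_Y, α∘f), π₁, π₂) is a pullback of the diagram Y → X ← X(G,S,α). -/
theorem voltExt_comp {Y X : SerreGraph} (f : GraphMorphism Y X) {S : Set X.E}
    (hS : X.IsOrientation S) {G : Type} [Group G] (α : S → G) (e : Y.E) :
    Y.voltExt (f.onE ⁻¹' S) (f.orientation_preimage hS)
        (fun s => α ⟨f.onE s.1, s.2⟩) e = X.voltExt S hS α (f.onE e) := by
  by_cases h : f.onE e ∈ S
  · rw [SerreGraph.voltExt, SerreGraph.voltExt, dif_pos h,
      dif_pos (show e ∈ f.onE ⁻¹' S from h)]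
  · rw [SerreGraph.voltExt, SerreGraph.voltExt, dif_neg h,
      dif_neg (show e ∉ f.onE ⁻¹' S from h)]
    exact inv_inj.mpr (congrArg α (Subtype.ext (f.map_bar e)))

/-- The morphism `π₂ : Y(G, S_Y, α∘f) → X(G, S, α)` of derived graphs induced by a graph
morphism `f : Y → X`, where `S_Y = f⁻¹(S)`; it is given by `(w,σ) ↦ (f w, σ)` on vertices and
`(e,σ) ↦ (f e, σ)` on directed edges. -/
noncomputable def derivedMap {Y X : SerreGraph} (f : GraphMorphism Y X) {S : Set X.E}
    (hS : X.IsOrientation S) {G : Type} [Group G] (α : S → G) :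
    GraphMorphism
      (Y.derived (f.onE ⁻¹' S) (f.orientation_preimage hS) (fun s => α ⟨f.onE s.1, s.2⟩))
      (X.derived S hS α) where
  onV := fun q => (f.onV q.1, q.2)
  onE := fun q => (f.onE q.1, q.2)
  map_o := fun e => Prod.ext (f.map_o e.1) rfl
  map_t := fun e => Prod.ext (f.map_t e.1) (by
    show e.2 * Y.voltExt (f.onE ⁻¹' S) (f.orientation_preimage hS)
        (fun s => α ⟨f.onE s.1, s.2⟩) e.1 = e.2 * X.voltExt S hS α (f.onE e.1)
    rw [voltExt_comp f hS α e.1])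
  map_bar := fun e => Prod.ext (f.map_bar e.1) (by
    show e.2 * Y.voltExt (f.onE ⁻¹' S) (f.orientation_preimage hS)
        (fun s => α ⟨f.onE s.1, s.2⟩) e.1 = e.2 * X.voltExt S hS α (f.onE e.1)
    rw [voltExt_comp f hS α e.1])

/-- The morphism `Z → Y(G, S_Y, α∘f)` induced by morphisms `Z → Y` and `Z → X(G, S, α)` that
agree after composition to `X`. -/
noncomputable def derivedLift {Y X Z : SerreGraph} (f : GraphMorphism Y X) {S : Set X.E}
    (hS : X.IsOrientation S) {G : Type} [Group G] (α : S → G) (a₁ : GraphMorphism Z Y)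
    (a₂ : GraphMorphism Z (X.derived S hS α))
    (h : f.comp a₁ = (X.derivedProj S hS α).comp a₂) :
    GraphMorphism Z
      (Y.derived (f.onE ⁻¹' S) (f.orientation_preimage hS) (fun s => α ⟨f.onE s.1, s.2⟩)) where
  onV := fun z => (a₁.onV z, (a₂.onV z).2)
  onE := fun e => (a₁.onE e, (a₂.onE e).2)
  map_o := fun e => Prod.ext (a₁.map_o e) (by
    show (a₂.onV (Z.o e)).2 = (a₂.onE e).2
    exact congrArg Prod.snd (a₂.map_o e))
  map_t := fun e => Prod.ext (a₁.map_t e) (by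
    have he : f.onE (a₁.onE e) = (a₂.onE e).1 := congrFun (congrArg GraphMorphism.onE h) e
    show (a₂.onV (Z.t e)).2 = (a₂.onE e).2 * Y.voltExt (f.onE ⁻¹' S) (f.orientation_preimage hS)
        (fun s => α ⟨f.onE s.1, s.2⟩) (a₁.onE e)
    rw [voltExt_comp f hS α, he]
    exact congrArg Prod.snd (a₂.map_t e))
  map_bar := fun e => Prod.ext (a₁.map_bar e) (by
    have he : f.onE (a₁.onE e) = (a₂.onE e).1 := congrFun (congrArg GraphMorphism.onE h) e
    show (a₂.onE (Z.bar e)).2 = (a₂.onE e).2 * Y.voltExt (f.onE ⁻¹' S) (f.orientation_preimage hS)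
        (fun s => α ⟨f.onE s.1, s.2⟩) (a₁.onE e)
    rw [voltExt_comp f hS α, he]
    exact congrArg Prod.snd (a₂.map_bar e))

/-- For a graph morphism `f : Y → X`, an orientation `S` of `X` with `S_Y := f⁻¹(S)`, and a
voltage assignment `α : S → G` into a finite abelian group, the triple
`(Y(G, S_Y, α∘f), π₁, π₂)` is a pullback of the diagram `Y → X ← X(G,S,α)`. -/
theorem derived_is_pullback {Y X : SerreGraph} (f : GraphMorphism Y X) (S : Set X.E)
    (hS : X.IsOrientation S) (G : Type) [CommGroup G] [Finite G] (α : S → G) :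
    f.comp (Y.derivedProj (f.onE ⁻¹' S) (f.orientation_preimage hS)
        (fun s => α ⟨f.onE s.1, s.2⟩)) =
      (X.derivedProj S hS α).comp (derivedMap f hS α) ∧
    ∀ (Z : SerreGraph) (a₁ : GraphMorphism Z Y)
        (a₂ : GraphMorphism Z (X.derived S hS α)),
      f.comp a₁ = (X.derivedProj S hS α).comp a₂ →
        ∃! φ : GraphMorphism Z
            (Y.derived (f.onE ⁻¹' S) (f.orientation_preimage hS)
              (fun s => α ⟨f.onE s.1, s.2⟩)),
          (Y.derivedProj (f.onE ⁻¹' S) (f.orientation_preimage hS)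
              (fun s => α ⟨f.onE s.1, s.2⟩)).comp φ = a₁ ∧
            (derivedMap f hS α).comp φ = a₂ := by
  refine ⟨rfl, fun Z a₁ a₂ h => ⟨derivedLift f hS α a₁ a₂ h, ⟨rfl, ?_⟩, ?_⟩⟩
  · refine GraphMorphism.ext (funext fun z => Prod.ext ?_ rfl) (funext fun e => Prod.ext ?_ rfl)
    · exact congrFun (congrArg GraphMorphism.onV h) z
    · exact congrFun (congrArg GraphMorphism.onE h) e
  · rintro φ ⟨rfl, rfl⟩
    rfl
end

section
/- Let X be a connected finite graph, G₁ and G₂ finite abelian groups, and S an orientation of X. Let β : S → G₂ and α : S → G₁ be voltage assignments such that both derived graphs X(G₂,S,β) and X(G₁,S,α) are connected. Set Y := X(G₂,S,β) with projection p₂ : Y → X, S_Y := p₂⁻¹(S), and let π₁ : Y(G₁, S_Y, α∘p₂) → Y be the projection; set p := p₂∘π₁. Let γ : S → G₂ × G₁ be the voltage assignment s ↦ (β(s), α(s)), and let π : X(G₂ × G₁, S, γ) → X be the projection. Then there is an isomorphism of graphs φ : X(G₂ × G₁, S, γ) → Y(G₁, S_Y, α∘p₂) satisfying p∘φ = π.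 -/
namespace SerreGraph

/-- The extension of a product voltage assignment is the product of the extensions. -/
theorem voltExt_prodMk (X : SerreGraph) (S : Set X.E) (hS : X.IsOrientation S) {G H : Type}
    [Group G] [Group H] (β : S → G) (α : S → H) (e : X.E) :
    X.voltExt S hS (fun s => (β s, α s)) e = (X.voltExt S hS β e, X.voltExt S hS α e) := by
  by_cases h : e ∈ S <;> simp [voltExt, h]

/-- Extending a voltage assignment commutes with pulling it back along a graph morphism. -/
theorem voltExt_preimage {Y X : SerreGraph} (f : GraphMorphism Y X) (S : Set X.E)
    (hS : X.IsOrientation S) {G : Type} [Group G] (α : S → G) (e : Y.E) :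
    Y.voltExt (f.onE ⁻¹' S) (f.orientation_preimage hS) (fun s => α ⟨f.onE s.1, s.2⟩) e =
      X.voltExt S hS α (f.onE e) := by
  by_cases h : f.onE e ∈ S <;> simp [voltExt, h, f.map_bar]

end SerreGraph

/-- Given voltage assignments `β : S → G₂` and `α : S → G₁` on a connected graph `X` with both
derived graphs connected, setting `Y := X(G₂,S,β)`, the derived graph
`X(G₂ × G₁, S, γ)` of the combined voltage assignment `γ(s) = (β(s), α(s))` is isomorphic,
compatibly with the projections to `X`, to the iterated derived graph `Y(G₁, S_Y, α∘p₂)`. -/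
theorem derived_combined_voltage (X : SerreGraph) [Finite X.V] [Finite X.E]
    (hXc : X.Connected) (G₂ G₁ : Type) [CommGroup G₂] [CommGroup G₁] [Finite G₂] [Finite G₁]
    (S : Set X.E) (hS : X.IsOrientation S) (β : S → G₂) (α : S → G₁)
    (hYconn : (X.derived S hS β).Connected) (hX1conn : (X.derived S hS α).Connected) :
    let Y := X.derived S hS β
    let p₂ := X.derivedProj S hS β
    let SY := p₂.onE ⁻¹' S
    let hSY := p₂.orientation_preimage hS
    let α' : SY → G₁ := fun s => α ⟨p₂.onE s.1, s.2⟩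
    let γ : S → G₂ × G₁ := fun s => (β s, α s)
    ∃ (φ : GraphMorphism (X.derived S hS γ) (Y.derived SY hSY α'))
      (ψ : GraphMorphism (Y.derived SY hSY α') (X.derived S hS γ)),
      ψ.comp φ = GraphMorphism.id _ ∧ φ.comp ψ = GraphMorphism.id _ ∧
        (p₂.comp (Y.derivedProj SY hSY α')).comp φ = X.derivedProj S hS γ := by
  intro Y p₂ SY hSY α' γ
  have hγ (e : X.E) : X.voltExt S hS γ e = (X.voltExt S hS β e, X.voltExt S hS α e) :=
    X.voltExt_prodMk S hS β α e
  have hα' (e : Y.E) : Y.voltExt SY hSY α' e = X.voltExt S hS α e.1 :=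
    SerreGraph.voltExt_preimage p₂ S hS α e
  have hβ (e : X.E) (g : G₂ × G₁) : (g * X.voltExt S hS γ e).1 = g.1 * X.voltExt S hS β e :=
    congrArg (fun x => g.1 * x.1) (hγ e)
  have hα (e : Y.E) (g : G₂ × G₁) :
      (g * X.voltExt S hS γ e.1).2 = g.2 * Y.voltExt SY hSY α' e := by
    rw [hα', hγ, Prod.snd_mul]
  exact ⟨
    { onV v := ((v.1, v.2.1), v.2.2)
      onE e := ((e.1, e.2.1), e.2.2)
      map_o _ := rfl
      map_t e := Prod.ext (Prod.ext rfl (hβ e.1 e.2)) (hα (e.1, e.2.1) e.2)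
      map_bar e := Prod.ext (Prod.ext rfl (hβ e.1 e.2)) (hα (e.1, e.2.1) e.2) },
    { onV v := (v.1.1, (v.1.2, v.2))
      onE e := (e.1.1, (e.1.2, e.2))
      map_o _ := rfl
      map_t e := Prod.ext rfl
        (Prod.ext (hβ e.1.1 (e.1.2, e.2)).symm (hα e.1 (e.1.2, e.2)).symm)
      map_bar e := Prod.ext rfl
        (Prod.ext (hβ e.1.1 (e.1.2, e.2)).symm (hα e.1 (e.1.2, e.2)).symm) },
    rfl, rfl, rfl⟩
end
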